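/- Let R be an integral domain with quotient field K. Then R is a PvMD if and only if for every pair of commutative K-algebras 𝒯 and 𝒮 and every pair of R-subalgebras A ⊆ 𝒯 and B ⊆ 𝒮, the canonical map μ_{A,B} : A ⊗_R B → 𝒯 ⊗_K 𝒮 induced by the inclusions has GV-torsion kernel. -/

import Mathlib

open TensorProduct

/-- A finitely generated ideal `J` is a GV-ideal if the natural map
`R → Hom_R(J, R)`, sending `r` to multiplication by `r`, is bijective. -/
def IsGVIdeal {R : Type*} [CommRing R] (J : Ideal R) : Prop :=
  J.FG ∧ Function.Bijective fun r : R => (r • J.subtype : J →ₗ[R] R)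

/-- An element `m` of an `R`-module is a GV-torsion element if it is
annihilated by some GV-ideal. -/
def IsGVTorsionElem (R : Type*) [CommRing R] {M : Type*} [AddCommGroup M] [Module R M]
    (m : M) : Prop :=
  ∃ J : Ideal R, IsGVIdeal J ∧ ∀ j ∈ J, j • m = 0

/-- `R` is a PvMD if for every nonzero finitely generated ideal `I` of `R` there is a
GV-ideal `J` with `J ⊆ I·I⁻¹` (inside the quotient field `K`). -/
def IsPvMD (R : Type*) [CommRing R] [IsDomain R] (K : Type*) [Field K] [Algebra R K]
    [IsFractionRing R K] : Prop :=
  ∀ I : Ideal R, I ≠ ⊥ → I.FG →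
    ∃ J : Ideal R, IsGVIdeal J ∧
      (J : FractionalIdeal (nonZeroDivisors R) K) ≤
        (I : FractionalIdeal (nonZeroDivisors R) K) *
          (I : FractionalIdeal (nonZeroDivisors R) K)⁻¹

/-- The canonical (Davis) map `A ⊗_R B → 𝒯 ⊗_K 𝒮`, `a ⊗ b ↦ a ⊗ b`, induced by the
inclusions `A ⊆ 𝒯` and `B ⊆ 𝒮`. -/
noncomputable def davisMap (R : Type*) [CommRing R] (K : Type*) [Field K] [Algebra R K]
    (𝒯 𝒮 : Type*) [CommRing 𝒯] [CommRing 𝒮] [Algebra K 𝒯] [Algebra K 𝒮]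
    [Algebra R 𝒯] [Algebra R 𝒮] [IsScalarTower R K 𝒯] [IsScalarTower R K 𝒮]
    (A : Subalgebra R 𝒯) (B : Subalgebra R 𝒮) :
    A ⊗[R] B →ₗ[R] 𝒯 ⊗[K] 𝒮 :=
  TensorProduct.lift <| LinearMap.mk₂ R (fun x y => (x : 𝒯) ⊗ₜ[K] (y : 𝒮))
    (by intro x₁ x₂ y; simp [TensorProduct.add_tmul])
    (by intro r x y; simp [TensorProduct.smul_tmul'])
    (by intro x y₁ y₂; simp [TensorProduct.tmul_add])
    (by intro r x y; simp [TensorProduct.tmul_smul])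

section GV

variable {R : Type*} [CommRing R] [IsDomain R]

/-- Over a domain, a finitely generated ideal is GV iff it is nonzero and every linear map to the
ring is a multiplication. -/
theorem isGVIdeal_iff {J : Ideal R} :
    IsGVIdeal J ↔ J.FG ∧ J ≠ ⊥ ∧ ∀ f : J →ₗ[R] R, ∃ r : R, ∀ j : J, f j = r * j := by
  refine and_congr_right fun _ => ⟨fun h => ⟨?_, fun f => ?_⟩, fun h => ⟨?_, fun f => ?_⟩⟩
  · rintro rfl
    exact one_ne_zero (h.1 (a₁ := (1 : R)) (a₂ := 0) (Subsingleton.elim _ _))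
  · obtain ⟨r, hr⟩ := h.2 f
    exact ⟨r, fun j => by simp [← hr]⟩
  · intro r s hrs
    obtain ⟨j, hj, hj0⟩ := Submodule.exists_mem_ne_zero_of_ne_bot h.1
    have := LinearMap.congr_fun hrs ⟨j, hj⟩
    exact mul_right_cancel₀ hj0 (by simpa using this)
  · obtain ⟨r, hr⟩ := h.2 f
    exact ⟨r, LinearMap.ext fun j => by simp [hr]⟩

theorem isGVIdeal_top : IsGVIdeal (⊤ : Ideal R) := by
  refine isGVIdeal_iff.2 ⟨⟨{1}, by simp⟩, top_ne_bot, fun f => ⟨f ⟨1, trivial⟩, fun j => ?_⟩⟩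
  have : j = (j : R) • (⟨1, trivial⟩ : (⊤ : Ideal R)) := Subtype.ext (by simp)
  conv_lhs => rw [this, map_smul]
  simp [mul_comm]

theorem IsGVIdeal.mul {I J : Ideal R} (hI : IsGVIdeal I) (hJ : IsGVIdeal J) :
    IsGVIdeal (I * J) := by
  obtain ⟨hI₁, hI₀, hI⟩ := isGVIdeal_iff.1 hI
  obtain ⟨hJ₁, hJ₀, hJ⟩ := isGVIdeal_iff.1 hJ
  refine isGVIdeal_iff.2 ⟨hI₁.mul hJ₁, mul_ne_zero hI₀ hJ₀, fun f => ?_⟩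
  have key : ∀ i : I, ∃ r : R, ∀ j : J,
      f ⟨i * j, Ideal.mul_mem_mul i.2 j.2⟩ = r * j := fun i => by
    obtain ⟨r, hr⟩ := hJ
      (f ∘ₗ ((i : R) • J.subtype).codRestrict (I * J) fun j => Ideal.mul_mem_mul i.2 j.2)
    exact ⟨r, fun j => hr j⟩
  choose g hg using key
  obtain ⟨j₀, hj₀, hj₀'⟩ := Submodule.exists_mem_ne_zero_of_ne_bot hJ₀
  obtain ⟨r, hr⟩ := hI
    { toFun := g
      map_add' := fun x y => by
        apply mul_right_cancel₀ hj₀'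
        rw [add_mul, ← hg _ ⟨j₀, hj₀⟩, ← hg _ ⟨j₀, hj₀⟩, ← hg _ ⟨j₀, hj₀⟩, ← map_add]
        congr 1
        exact Subtype.ext (add_mul _ _ _)
      map_smul' := fun c x => by
        apply mul_right_cancel₀ hj₀'
        rw [RingHom.id_apply, smul_eq_mul, mul_assoc, ← hg _ ⟨j₀, hj₀⟩, ← hg _ ⟨j₀, hj₀⟩]
        refine (congrArg f (Subtype.ext ?_)).trans (map_smul f c _)
        exact mul_assoc _ _ _ }
  refine ⟨r, fun ⟨x, hx⟩ => ?_⟩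
  refine Submodule.mul_induction_on' (C := fun x hx => f ⟨x, hx⟩ = r * x) ?_ ?_ hx
  · intro i hi j hj
    have h₁ := hg ⟨i, hi⟩ ⟨j, hj⟩
    have h₂ : g ⟨i, hi⟩ = r * i := hr ⟨i, hi⟩
    rw [h₁, h₂, mul_assoc]
  · intro x hx y hy h₁ h₂
    rw [mul_add, ← h₁, ← h₂, ← map_add]
    rfl

variable {M : Type*} [AddCommGroup M] [Module R M]

theorem IsGVTorsionElem.add {x y : M} (hx : IsGVTorsionElem R x) (hy : IsGVTorsionElem R y) :
    IsGVTorsionElem R (x + y) := by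
  obtain ⟨I, hI, hx⟩ := hx
  obtain ⟨J, hJ, hy⟩ := hy
  refine ⟨I * J, hI.mul hJ, fun k hk => ?_⟩
  have hkI : k ∈ I := Ideal.mul_le_left hk
  have hkJ : k ∈ J := Ideal.mul_le_right hk
  rw [smul_add, hx k hkI, hy k hkJ, add_zero]

variable (R M) in
/-- The submodule of GV-torsion elements. -/
def gvTorsion : Submodule R M where
  carrier := {m | IsGVTorsionElem R m}
  zero_mem' := ⟨⊤, isGVIdeal_top, fun _ _ => smul_zero _⟩
  add_mem' := IsGVTorsionElem.add
  smul_mem' c _ hx :=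
    hx.imp fun _ h => ⟨h.1, fun i hi => by rw [smul_comm, h.2 i hi, smul_zero]⟩

/-- An element all of whose multiples by a GV-ideal are GV-torsion is itself GV-torsion. -/
theorem IsGVIdeal.mem_gvTorsion_of_forall_smul_mem {J : Ideal R} (hJ : IsGVIdeal J) {m : M}
    (h : ∀ j ∈ J, j • m ∈ gvTorsion R M) : m ∈ gvTorsion R M := by
  classical
  obtain ⟨s, rfl⟩ := hJ.1
  have key : ∀ t : Finset R, t ⊆ s → ∃ I : Ideal R, IsGVIdeal I ∧ ∀ j ∈ t, ∀ i ∈ I,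
      i • j • m = 0 := by
    intro t
    induction t using Finset.induction_on with
    | empty => exact fun _ => ⟨⊤, isGVIdeal_top, by simp⟩
    | insert a t _ ih =>
      intro hts
      rw [Finset.insert_subset_iff] at hts
      obtain ⟨I, hI, hI'⟩ := ih hts.2
      obtain ⟨I', hI₁, hI₂⟩ := h a (Submodule.subset_span hts.1)
      refine ⟨I' * I, hI₁.mul hI, fun j hj i hi => ?_⟩
      rcases Finset.mem_insert.1 hj with rfl | hj
      · exact hI₂ i (Ideal.mul_le_left hi)
      · exact hI' j hj i (Ideal.mul_le_right hi)
  obtain ⟨I, hI, hI'⟩ := key s subset_rfl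
  refine ⟨I * Submodule.span R s, hI.mul hJ, fun k hk => ?_⟩
  have hle : I * Submodule.span R s ≤ LinearMap.ker (LinearMap.toSpanSingleton R M m) := by
    refine Ideal.mul_le.2 fun i hi j hj => ?_
    refine Submodule.span_induction (p := fun j _ => i * j ∈ _) ?_ ?_ ?_ ?_ hj
    · intro x hx
      simpa [mul_smul] using hI' x hx i hi
    · simp
    · intro x y _ _ hx hy
      rw [mul_add]
      exact add_mem hx hy
    · intro c x _ hx
      rw [smul_eq_mul, mul_left_comm]
      exact Ideal.mul_mem_left _ _ hx
  simpa using hle hk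

end GV

section Forward

variable {R : Type*} [CommRing R] [IsDomain R] {K : Type*} [Field K] [Algebra R K]
  [IsFractionRing R K]

/-- Over a PvMD, given a nonzero finite family `r`, an element `m` is GV-torsion as soon as
`(q r_k) m` is for every index `k` and every `q ∈ K` such that all `q r_i` lie in `R`. -/
theorem IsPvMD.mem_gvTorsion_of_forall_smul_mem (hR : IsPvMD R K) {M : Type*} [AddCommGroup M]
    [Module R M] {ι : Type*} [Finite ι] {r : ι → R} (hr : r ≠ 0) {m : M}
    (h : ∀ (q : K) (d : ι → R), (∀ i, algebraMap R K (d i) = q * algebraMap R K (r i)) →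
      ∀ k, d k • m ∈ gvTorsion R M) : m ∈ gvTorsion R M := by
  obtain ⟨i₀, hi₀⟩ := Function.ne_iff.1 hr
  have hI₀ : Ideal.span (Set.range r) ≠ ⊥ := fun h₀ =>
    hi₀ (by simpa [h₀] using Ideal.subset_span (s := Set.range r) ⟨i₀, rfl⟩)
  obtain ⟨J, hJ, hle⟩ := hR _ hI₀ (Submodule.fg_span (Set.finite_range r))
  refine hJ.mem_gvTorsion_of_forall_smul_mem fun j hj => ?_
  let D : Submodule R R := (gvTorsion R M).comap (LinearMap.toSpanSingleton R M m)
  suffices hD : algebraMap R K j ∈ D.map (Algebra.linearMap R K) by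
    obtain ⟨d, hd, hdj⟩ := hD
    obtain rfl : d = j := IsFractionRing.injective R K hdj
    exact hd
  have hj' := hle (FractionalIdeal.mem_coeIdeal_of_mem _ hj)
  rw [← FractionalIdeal.mem_coe, FractionalIdeal.coe_mul] at hj'
  refine Submodule.mul_le.2 (fun x hx q hq => ?_) hj'
  rw [FractionalIdeal.mem_coe, FractionalIdeal.mem_inv_iff
    (FractionalIdeal.coeIdeal_ne_zero.2 hI₀)] at hq
  have hd : ∀ i, ∃ d : R, algebraMap R K d = q * algebraMap R K (r i) := fun i =>
    (FractionalIdeal.mem_one_iff _).1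
      (hq _ (FractionalIdeal.mem_coeIdeal_of_mem _ (Ideal.subset_span ⟨i, rfl⟩)))
  choose d hd using hd
  obtain ⟨i, hi, rfl⟩ := (FractionalIdeal.mem_coeIdeal _).1 hx
  have hspan : Ideal.span (Set.range r) ≤ (D.map (Algebra.linearMap R K)).comap
      (LinearMap.toSpanSingleton R K q) := by
    refine Ideal.span_le.2 ?_
    rintro _ ⟨k, rfl⟩
    exact ⟨d k, h q d hd k, by simp [hd, Algebra.smul_def, mul_comm]⟩
  simpa [Algebra.smul_def] using hspan hi

variable {T S : Type*} [AddCommGroup T] [AddCommGroup S] [Module K T] [Module K S]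
  [Module R T] [Module R S] [IsScalarTower R K T] [IsScalarTower R K S]

theorem eq_zero_of_sum_tmul_eq_zero_of_linearIndependent {ι : Type*} [Fintype ι] {a : ι → T}
    {b : ι → S} (ha : LinearIndependent K a) (h : ∑ i, a i ⊗ₜ[K] b i = 0) : b = 0 := by
  obtain ⟨κ, c, y, hy, hc⟩ :=
    TensorProduct.vanishesTrivially_of_sum_tmul_eq_zero_of_rTensor_injective K
      (Module.Flat.rTensor_preserves_injective_linearMap _ (Submodule.injective_subtype _)) h
  funext i
  rw [hy i]
  refine Finset.sum_eq_zero fun j _ => ?_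
  rw [Fintype.linearIndependent_iff.1 ha (fun i => c i j) (hc j) i, zero_smul]

/-- Over a PvMD, a tensor of elements of lattices in `K`-vector spaces that vanishes after
extension to `K` is GV-torsion. -/
theorem IsPvMD.sum_tmul_mem_gvTorsion (hR : IsPvMD R K) (A : Submodule R T) (B : Submodule R S)
    {n : ℕ} (a : Fin n → A) (b : Fin n → B) (h : ∑ i, (a i : T) ⊗ₜ[K] (b i : S) = 0) :
    ∑ i, a i ⊗ₜ[R] b i ∈ gvTorsion R (A ⊗[R] B) := by
  induction n with
  | zero => simp
  | succ n ih =>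
    by_cases ha : LinearIndependent K fun i => (a i : T)
    · have hb := eq_zero_of_sum_tmul_eq_zero_of_linearIndependent ha h
      have hb' : ∀ i, b i = 0 := fun i => Subtype.ext (congrFun hb i)
      simp [hb']
    rw [← LinearIndependent.iff_fractionRing (R := R), Fintype.linearIndependent_iff] at ha
    push Not at ha
    obtain ⟨r, hra, i₀, hi₀⟩ := ha
    refine hR.mem_gvTorsion_of_forall_smul_mem (Function.ne_iff.2 ⟨i₀, hi₀⟩) fun q d hd k => ?_
    have hda : ∑ i, d i • a i = 0 := by
      apply Subtype.ext
      have : ∑ i, d i • (a i : T) = q • ∑ i, r i • (a i : T) := by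
        rw [Finset.smul_sum]
        refine Finset.sum_congr rfl fun i _ => ?_
        rw [← algebraMap_smul K (d i), hd, mul_smul, algebraMap_smul]
      simpa [hra] using this
    rw [Fin.sum_univ_succAbove _ k] at hda
    have hk : d k • a k = -∑ i, d (k.succAbove i) • a (k.succAbove i) :=
      eq_neg_of_add_eq_zero_left hda
    let b' : Fin n → B := fun i => d k • b (k.succAbove i) - d (k.succAbove i) • b k
    have heq : d k • ∑ i, a i ⊗ₜ[R] b i = ∑ i, a (k.succAbove i) ⊗ₜ[R] b' i := by
      rw [Fin.sum_univ_succAbove _ k, smul_add, TensorProduct.smul_tmul', hk,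
        TensorProduct.neg_tmul, TensorProduct.sum_tmul, Finset.smul_sum, neg_add_eq_sub,
        ← Finset.sum_sub_distrib]
      refine Finset.sum_congr rfl fun i _ => ?_
      rw [TensorProduct.tmul_sub, TensorProduct.tmul_smul, TensorProduct.tmul_smul,
        TensorProduct.smul_tmul', TensorProduct.smul_tmul']
    have hkT : algebraMap R K (d k) • (a k : T) =
        -∑ i, algebraMap R K (d (k.succAbove i)) • (a (k.succAbove i) : T) := by
      simpa using congrArg (Subtype.val : A → T) hk
    rw [heq]
    refine ih _ _ ?_
    have : algebraMap R K (d k) • ∑ i, (a i : T) ⊗ₜ[K] (b i : S) =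
        ∑ i, (a (k.succAbove i) : T) ⊗ₜ[K] (b' i : S) := by
      rw [Fin.sum_univ_succAbove _ k, smul_add, TensorProduct.smul_tmul', hkT,
        TensorProduct.neg_tmul, TensorProduct.sum_tmul, Finset.smul_sum, neg_add_eq_sub,
        ← Finset.sum_sub_distrib]
      refine Finset.sum_congr rfl fun i _ => ?_
      simp only [b', Submodule.coe_sub, Submodule.coe_smul]
      rw [TensorProduct.tmul_sub, ← algebraMap_smul K (d k), ← algebraMap_smul K (d _) (b k : S),
        TensorProduct.tmul_smul, TensorProduct.tmul_smul, TensorProduct.smul_tmul',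
          TensorProduct.smul_tmul']
    rw [← this, h, smul_zero]

end Forward

theorem davisMap_tmul {R K T S : Type*} [CommRing R] [Field K] [Algebra R K] [CommRing T]
    [CommRing S] [Algebra K T] [Algebra K S] [Algebra R T] [Algebra R S] [IsScalarTower R K T]
    [IsScalarTower R K S] (A : Subalgebra R T) (B : Subalgebra R S) (x : A) (y : B) :
    davisMap R K T S A B (x ⊗ₜ y) = (x : T) ⊗ₜ[K] (y : S) := rfl

section Backward

variable {R : Type*} [CommRing R] {K : Type*} [Field K] [Algebra R K]

/-- The subalgebra `R ⊕ Mε` of the trivial square-zero extension `K ⊕ Vε`, for an `R`-submodule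
`M` of `V`. -/
def trivSqZeroSubalgebra {V : Type*} [AddCommGroup V] [Module K V] [Module Kᵐᵒᵖ V]
    [IsCentralScalar K V] [Module R V] [IsScalarTower R K V] (M : Submodule R V) :
    Subalgebra R (TrivSqZeroExt K V) where
  carrier := {z | z.fst ∈ (algebraMap R K).range ∧ z.snd ∈ M}
  mul_mem' := by
    rintro x y ⟨⟨r, hr⟩, hx⟩ ⟨⟨s, hs⟩, hy⟩
    refine ⟨⟨r * s, by simp [hr, hs]⟩, ?_⟩
    rw [TrivSqZeroExt.snd_mul, op_smul_eq_smul, ← hr, ← hs, algebraMap_smul, algebraMap_smul]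
    exact add_mem (M.smul_mem _ hy) (M.smul_mem _ hx)
  add_mem' := by
    rintro x y ⟨hx₁, hx₂⟩ ⟨hy₁, hy₂⟩
    exact ⟨add_mem hx₁ hy₁, add_mem hx₂ hy₂⟩
  algebraMap_mem' r := ⟨⟨r, rfl⟩, M.zero_mem⟩

section

variable {V : Type*} [AddCommGroup V] [Module K V] [Module Kᵐᵒᵖ V]
    [IsCentralScalar K V] [Module R V] [IsScalarTower R K V] (M : Submodule R V)

/-- The projection `R ⊕ Mε → M`. -/
def trivSqZeroSubalgebraSnd : trivSqZeroSubalgebra (K := K) M →ₗ[R] M where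
  toFun z := ⟨(z : TrivSqZeroExt K V).snd, z.2.2⟩
  map_add' _ _ := rfl
  map_smul' _ _ := rfl

/-- The element `mε` of `R ⊕ Mε`. -/
def trivSqZeroSubalgebraInr (m : M) : trivSqZeroSubalgebra (K := K) M :=
  ⟨TrivSqZeroExt.inr m, ⟨0, by simp⟩, m.2⟩

theorem trivSqZeroSubalgebraSnd_inr (m : M) :
    trivSqZeroSubalgebraSnd (K := K) M (trivSqZeroSubalgebraInr M m) = m := rfl

end

variable (R K) in
/-- The kernel condition on Davis maps, restricted to one pair of trivial square-zero extensions,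
passes to submodules of `K`-vector spaces. -/
theorem isGVTorsionElem_sum_tmul {V W : Type*} [AddCommGroup V] [Module K V] [Module Kᵐᵒᵖ V]
    [IsCentralScalar K V] [Module R V] [IsScalarTower R K V] [AddCommGroup W] [Module K W]
    [Module Kᵐᵒᵖ W] [IsCentralScalar K W] [Module R W] [IsScalarTower R K W]
    (M : Submodule R V) (N : Submodule R W)
    (h : ∀ x ∈ LinearMap.ker (davisMap R K (TrivSqZeroExt K V) (TrivSqZeroExt K W)
      (trivSqZeroSubalgebra M) (trivSqZeroSubalgebra N)), IsGVTorsionElem R x)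
    {ι : Type*} [Fintype ι] (m : ι → M) (n : ι → N)
    (hmn : ∑ i, (m i : V) ⊗ₜ[K] (n i : W) = 0) :
    IsGVTorsionElem R (∑ i, m i ⊗ₜ[R] n i) := by
  obtain ⟨J, hJ, hJx⟩ := h (∑ i, trivSqZeroSubalgebraInr M (m i) ⊗ₜ[R]
    trivSqZeroSubalgebraInr N (n i)) (by
      have := congrArg (TensorProduct.map (TrivSqZeroExt.inrHom K V) (TrivSqZeroExt.inrHom K W))
        hmn
      simpa [davisMap_tmul, trivSqZeroSubalgebraInr] using this)
  refine ⟨J, hJ, fun j hj => ?_⟩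
  have := congrArg (TensorProduct.map (trivSqZeroSubalgebraSnd (K := K) M)
    (trivSqZeroSubalgebraSnd (K := K) N)) (hJx j hj)
  simpa [trivSqZeroSubalgebraSnd_inr] using this

open scoped nonZeroDivisors

/-- Testing GV-torsion of the tensor `∑ aᵢ ⊗ ēᵢ`, with `ēᵢ` the images of the standard basis in
`Kⁿ / K(a₁, …, aₙ)`, makes the ideal `(a₁, …, aₙ)` invertible up to a GV-ideal. -/
theorem exists_isGVIdeal_le_mul_inv [IsDomain R] [IsFractionRing R K] {n : ℕ} (a : Fin n → R)
    (ha : a ≠ 0) (α : Fin n → K) (hα : ∀ i, α i = algebraMap R K (a i))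
    (h : ∀ (M : Submodule R K) (N : Submodule R ((Fin n → K) ⧸ K ∙ α)) (m : Fin n → M)
      (v : Fin n → N), ∑ i, (m i : K) ⊗ₜ[K] (v i : (Fin n → K) ⧸ K ∙ α) = 0 →
        IsGVTorsionElem R (∑ i, m i ⊗ₜ[R] v i)) :
    ∃ J : Ideal R, IsGVIdeal J ∧ (J : FractionalIdeal R⁰ K) ≤
      (Ideal.span (Set.range a) : FractionalIdeal R⁰ K) *
        (Ideal.span (Set.range a) : FractionalIdeal R⁰ K)⁻¹ := by
  set I : Ideal R := Ideal.span (Set.range a)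
  have haI : ∀ i, a i ∈ I := fun i => Ideal.subset_span ⟨i, rfl⟩
  obtain ⟨i₀, hi₀⟩ := Function.ne_iff.1 ha
  have hI₀ : (I : FractionalIdeal R⁰ K) ≠ 0 := FractionalIdeal.coeIdeal_ne_zero.2 fun h₀ =>
    hi₀ (by simpa [h₀] using haI i₀)
  have hα₀ : α i₀ ≠ 0 := by
    rw [hα]
    exact fun h₀ => hi₀ (IsFractionRing.injective R K (h₀.trans (map_zero _).symm))
  let G : (Fin n → R) →ₗ[R] (Fin n → K) := (Algebra.linearMap R K).compLeft (Fin n)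
  let P : (Fin n → R) →ₗ[R] (Fin n → K) ⧸ K ∙ α := (K ∙ α).mkQ.restrictScalars R ∘ₗ G
  let C : Submodule R K := (I * (I : FractionalIdeal R⁰ K)⁻¹ : FractionalIdeal R⁰ K)
  let D : Submodule R (Fin n → K) := C.map ((LinearMap.toSpanSingleton K _ α).restrictScalars R)
  let M : Submodule R K := (I : FractionalIdeal R⁰ K)
  let g : (Fin n → R) →ₗ[R] M →ₗ[R] (Fin n → K) ⧸ D :=
    LinearMap.mk₂ R (fun v m => D.mkQ ((m : K) • G v))
      (fun v w m => by rw [map_add, smul_add, map_add])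
      (fun c v m => by rw [G.map_smul, smul_comm, D.mkQ.map_smul])
      (fun v m m' => by rw [Submodule.coe_add, add_smul, map_add])
      (fun c v m => by rw [Submodule.coe_smul, smul_assoc, map_smul])
  have hg : LinearMap.ker P ≤ LinearMap.ker g := by
    intro v hv
    obtain ⟨c, hc⟩ := Submodule.mem_span_singleton.1
      ((Submodule.Quotient.mk_eq_zero _).1 (show (K ∙ α).mkQ (G v) = 0 from hv))
    have hcI : c ∈ (I : FractionalIdeal R⁰ K)⁻¹ := by
      rw [FractionalIdeal.mem_inv_iff hI₀]
      intro y hy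
      obtain ⟨x, hx, rfl⟩ := (FractionalIdeal.mem_coeIdeal _).1 hy
      have hle : I ≤ (1 : Submodule R K).comap (LinearMap.toSpanSingleton R K c) := by
        refine Ideal.span_le.2 ?_
        rintro _ ⟨i, rfl⟩
        refine Submodule.mem_one.2 ⟨v i, ?_⟩
        have hci : c * α i = algebraMap R K (v i) := congrFun hc i
        rw [LinearMap.toSpanSingleton_apply, Algebra.smul_def, ← hci, hα, mul_comm]
      obtain ⟨z, hz⟩ := Submodule.mem_one.1 (hle hx)
      refine (FractionalIdeal.mem_one_iff _).2 ⟨z, ?_⟩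
      rw [hz, LinearMap.toSpanSingleton_apply, Algebra.smul_def, mul_comm]
    refine LinearMap.ext fun m => (Submodule.Quotient.mk_eq_zero _).2 ?_
    exact ⟨m * c, FractionalIdeal.mul_mem_mul m.2 hcI, by simp [← hc, mul_smul]⟩
  let f : LinearMap.range P →ₗ[R] M →ₗ[R] (Fin n → K) ⧸ D :=
    (LinearMap.ker P).liftQ g hg ∘ₗ P.quotKerEquivRange.symm.toLinearMap
  have hf : ∀ v (m : M), f ⟨P v, v, rfl⟩ m = D.mkQ ((m : K) • G v) := fun v m => by
    simp only [f, LinearMap.comp_apply, LinearEquiv.coe_coe]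
    rw [LinearMap.quotKerEquivRange_symm_apply_image P v ⟨v, rfl⟩]
    rfl
  have hsum : ∑ i, α i • G (Pi.single i 1) = α := by
    funext k
    simp [G, Pi.single_apply, Finset.sum_apply, apply_ite]
  let m : Fin n → M := fun i =>
    ⟨α i, (FractionalIdeal.mem_coeIdeal _).2 ⟨a i, haI i, (hα i).symm⟩⟩
  let v : Fin n → LinearMap.range P := fun i => ⟨P (Pi.single i 1), _, rfl⟩
  obtain ⟨J, hJ, hJx⟩ := h M (LinearMap.range P) m v (by
    apply (TensorProduct.lid K _).injective
    have : (K ∙ α).mkQ (∑ i, α i • G (Pi.single i 1)) = 0 := by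
      rw [hsum]
      exact (Submodule.Quotient.mk_eq_zero _).2 (Submodule.mem_span_singleton_self α)
    rw [map_sum] at this
    rw [map_sum, map_zero, ← this]
    exact Finset.sum_congr rfl fun i _ => rfl)
  refine ⟨J, hJ, fun y hy => ?_⟩
  obtain ⟨j, hj, rfl⟩ := (FractionalIdeal.mem_coeIdeal _).1 hy
  have hjx := congrArg (TensorProduct.lift f.flip) (hJx j hj)
  rw [map_smul, map_sum, map_zero] at hjx
  simp only [TensorProduct.lift.tmul, LinearMap.flip_apply, v, hf, m] at hjx
  rw [← map_sum, hsum, ← map_smul] at hjx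
  obtain ⟨t, ht, htj⟩ := (Submodule.Quotient.mk_eq_zero _).1 hjx
  have : t * α i₀ = algebraMap R K j * α i₀ := by
    rw [← Algebra.smul_def]
    exact congrFun htj i₀
  rw [← mul_right_cancel₀ hα₀ this]
  exact ht

end Backward

/-- `R` is a PvMD iff for every pair of commutative `K`-algebras `𝒯`, `𝒮`
and `R`-subalgebras `A ⊆ 𝒯`, `B ⊆ 𝒮`, the canonical map `A ⊗_R B → 𝒯 ⊗_K 𝒮` has
GV-torsion kernel. -/
theorem pvmd_iff_davisMap_gvTorsion_kernel
    {R : Type u} [CommRing R] [IsDomain R]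
    (K : Type u) [Field K] [Algebra R K] [IsFractionRing R K] :
    IsPvMD R K ↔
      ∀ (𝒯 𝒮 : Type u) [CommRing 𝒯] [CommRing 𝒮] [Algebra K 𝒯] [Algebra K 𝒮]
        [Algebra R 𝒯] [Algebra R 𝒮] [IsScalarTower R K 𝒯] [IsScalarTower R K 𝒮]
        (A : Subalgebra R 𝒯) (B : Subalgebra R 𝒮),
        ∀ x ∈ LinearMap.ker (davisMap R K 𝒯 𝒮 A B), IsGVTorsionElem R x := by
  constructor
  · intro hR 𝒯 𝒮 _ _ _ _ _ _ _ _ A B x hx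
    obtain ⟨s, rfl⟩ := TensorProduct.exists_finset x
    let e := s.equivFin.symm
    have hs : ∀ {M : Type u} [AddCommMonoid M] (F : A × B → M),
        ∑ p ∈ s, F p = ∑ i, F (e i) := fun F => by
      rw [← Finset.sum_coe_sort s F, e.sum_comp (fun p => F p)]
    rw [LinearMap.mem_ker, map_sum] at hx
    simp only [davisMap_tmul] at hx
    rw [hs] at hx ⊢
    exact hR.sum_tmul_mem_gvTorsion A.toSubmodule B.toSubmodule
      (fun i => (e i).1.1) (fun i => (e i).1.2) hx
  · intro h I hI₀ hI
    obtain ⟨n, a, rfl⟩ := Submodule.fg_iff_exists_fin_generating_family.1 hI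
    refine exists_isGVIdeal_le_mul_inv a ?_ (fun i => algebraMap R K (a i)) (fun _ => rfl)
      fun M N m v hmv => isGVTorsionElem_sum_tmul R K M N (h _ _ _ _) m v hmv
    rintro rfl
    exact hI₀ (Submodule.span_eq_bot.2 (by simp))
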